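/- Let k ≥ 1 and let c_1,…,c_k be integers with c_i ≥ 2 for all i. Then the polynomials E_k(c_1,…,c_k)_q and E_{k−1}(c_2,…,c_k)_q are coprime in ℚ[q] (equivalently, their images in ℚ[q] generate the unit ideal). -/

import Mathlib

/-- The `q`-integer `[c]_q = 1 + q + ⋯ + q^{c-1}` in `ℤ[q]`. -/
noncomputable def qN (c : ℕ) : Polynomial ℤ := ∑ i ∈ Finset.range c, Polynomial.X ^ i

/-- The tridiagonal matrix whose determinant is the `q`-continuant
`E_k(c_1,…,c_k)_q` (here `c` is 0-indexed: `c 0 = c_1`). -/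
noncomputable def Emat (k : ℕ) (c : ℕ → ℕ) : Matrix (Fin k) (Fin k) (Polynomial ℤ) :=
  Matrix.of fun i j =>
    if (i : ℕ) = (j : ℕ) then qN (c i)
    else if (j : ℕ) = (i : ℕ) + 1 then Polynomial.X ^ (c i - 1)
    else if (i : ℕ) = (j : ℕ) + 1 then 1
    else 0

/-- The `q`-continuant `E_k(c_1,…,c_k)_q ∈ ℤ[q]` (0-indexed `c`); `Econt 0 c = 1`. -/
noncomputable def Econt (k : ℕ) (c : ℕ → ℕ) : Polynomial ℤ := (Emat k c).det

/-- The matrix `M(c_1,…,c_k)_q = ∏_{i=1}^{k} [[ [c_i]_q, −q^{c_i−1} ], [1, 0]]` over `ℤ[q]`. -/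
noncomputable def Mmat (k : ℕ) (c : ℕ → ℕ) : Matrix (Fin 2) (Fin 2) (Polynomial ℤ) :=
  ((List.range k).map fun i => !![qN (c i), -(Polynomial.X ^ (c i - 1)); 1, 0]).prod

open Polynomial in
theorem Econt_rec (n : ℕ) (c : ℕ → ℕ) :
    Econt (n + 2) c = qN (c 0) * Econt (n + 1) (fun i => c (i + 1))
      - X ^ (c 0 - 1) * Econt n (fun i => c (i + 2)) := by
  unfold Econt
  rw [Matrix.det_succ_row_zero, Fin.sum_univ_succ, Fin.sum_univ_succ]
  have h0 : (Emat (n + 2) c).submatrix Fin.succ (Fin.succAbove 0)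
      = Emat (n + 1) (fun i => c (i + 1)) := by
    ext i j : 2
    simp [Emat]
  have h1 : ((Emat (n + 2) c).submatrix Fin.succ
      (Fin.succAbove (Fin.succ 0))).det = (Emat n (fun i => c (i + 2))).det := by
    rw [Matrix.det_succ_column_zero, Fin.sum_univ_succ, Finset.sum_eq_zero]
    · have : ((Emat (n + 2) c).submatrix Fin.succ (Fin.succAbove (Fin.succ 0))).submatrix
          (Fin.succAbove 0) Fin.succ = Emat n (fun i => c (i + 2)) := by
        ext i j : 2
        simp [Emat]
      rw [this]
      simp [Emat]
    · intro i _
      simp [Emat]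
  rw [h0, h1, Finset.sum_eq_zero]
  · simp [Emat]
    ring
  · intro i _
    simp [Emat]

open Polynomial in
theorem Econt_zero (c : ℕ → ℕ) : Econt 0 c = 1 := by simp [Econt]

theorem Econt_one (c : ℕ → ℕ) : Econt 1 c = qN (c 0) := by simp [Econt, Emat]

open Polynomial in
theorem qN_coeff_zero (m : ℕ) (h : 2 ≤ m) : (qN m).eval 0 = 1 := by
  obtain ⟨m, rfl⟩ := Nat.exists_eq_add_of_le' h
  simp [qN, eval_finsetSum, Finset.sum_range_succ']

open Polynomial in
theorem Econt_eval_zero (k : ℕ) : ∀ c : ℕ → ℕ, (∀ i < k, 2 ≤ c i) → (Econt k c).eval 0 = 1 := by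
  induction k using Nat.strong_induction_on with
  | _ k ih =>
    intro c hc
    match k, ih, hc with
    | 0, _, _ => simp [Econt_zero]
    | 1, _, hc => rw [Econt_one, qN_coeff_zero _ (hc 0 (by omega))]
    | n + 2, ih, hc =>
      have h2 := hc 0 (by omega)
      have : c 0 - 1 ≠ 0 := by omega
      rw [Econt_rec, eval_sub, eval_mul, eval_mul, qN_coeff_zero _ h2,
        ih (n + 1) (by omega) _ (fun i hi => hc _ (by omega))]
      simp [this]

/-- for `k ≥ 1` and integers `c_i ≥ 2`, the polynomials `E_k(c_1,…,c_k)_q`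
and `E_{k−1}(c_2,…,c_k)_q` are coprime in `ℚ[q]`. -/
theorem Econt_coprime (k : ℕ) (hk : 1 ≤ k) (c : ℕ → ℕ) (hc : ∀ i < k, 2 ≤ c i) :
    IsCoprime ((Econt k c).map (Int.castRingHom ℚ))
      ((Econt (k - 1) (fun i => c (i + 1))).map (Int.castRingHom ℚ)) := by
  obtain ⟨n, rfl⟩ := Nat.exists_eq_add_of_le' hk
  clear hk
  suffices h : IsCoprime (Econt (n + 1) c) (Econt n (fun i => c (i + 1))) by
    exact h.map (Polynomial.mapRingHom (Int.castRingHom ℚ))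
  induction n generalizing c with
  | zero => rw [Econt_zero]; exact isCoprime_one_right
  | succ n ih =>
    have h1 := ih (fun i => c (i + 1)) (fun i hi => hc _ (by omega))
    have h2 : IsCoprime (Polynomial.X : Polynomial ℤ) (Econt (n + 1) (fun i => c (i + 1))) := by
      have he := Econt_eval_zero (n + 1) (fun i => c (i + 1)) (fun i hi => hc _ (by omega))
      have hd : Polynomial.X ∣ Econt (n + 1) (fun i => c (i + 1)) - 1 := by
        rw [Polynomial.X_dvd_iff, Polynomial.coeff_zero_eq_eval_zero]
        simp [he]
      obtain ⟨r, hr⟩ := hd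
      exact ⟨-r, 1, by linear_combination hr⟩
    have h3 : IsCoprime (Polynomial.X ^ (c 0 - 1) * Econt n (fun i => c (i + 2)))
        (Econt (n + 1) (fun i => c (i + 1))) := (h2.pow_left).mul_left h1.symm
    rw [Econt_rec]
    obtain ⟨a, b, hab⟩ := h3
    exact ⟨-a, b + a * qN (c 0), by linear_combination hab⟩
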